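/- Let 𝒜 ⊆ Fin p be a set of active indices with complement 𝒜ᶜ (as a Finset of cardinality p − |𝒜|), let d, r ∈ ℕ with r ≤ p − |𝒜| and d² ≤ p − |𝒜|, and let Â⁽¹⁾, Â⁽²⁾ : Ω → Finset (Fin p) be independent random finsets with the same distribution. Suppose: (i) μ-almost surely (Â⁽¹⁾(ω) ∩ 𝒜ᶜ).card ≤ d; (ii) the map T ↦ μ{ω : T ⊆ Â⁽¹⁾(ω)} is constant on the r-element subsets of 𝒜ᶜ. Then μ{ω : r ≤ (Â⁽¹⁾(ω) ∩ Â⁽²⁾(ω) ∩ 𝒜ᶜ).card} ≤ (1 / r !) · (d² / (p − |𝒜|))^r. -/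

import Mathlib

open MeasureTheory ProbabilityTheory

/-- The discrete σ-algebra on finsets of indices. -/
instance finsetFinMeasurableSpace (p : ℕ) : MeasurableSpace (Finset (Fin p)) := ⊤

theorem Nat.descFactorial_sq_mul_pow_le {d n : ℕ} (hdn : d ≤ n) (r : ℕ) :
    d.descFactorial r ^ 2 * n ^ r ≤ (d ^ 2) ^ r * n.descFactorial r := by
  induction r with
  | zero => simp
  | succ k ih =>
    have key : (d - k) ^ 2 * n ≤ d ^ 2 * (n - k) := by
      rcases le_total d k with h | h
      · simp [Nat.sub_eq_zero_of_le h]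
      · obtain ⟨a, rfl⟩ := Nat.exists_eq_add_of_le h
        obtain ⟨b, rfl⟩ := Nat.exists_eq_add_of_le hdn
        rw [Nat.add_sub_cancel_left, show k + a + b - k = a + b by lia]
        nlinarith [Nat.zero_le (k * a * b), Nat.zero_le (k * k * b), Nat.zero_le (k * a * a),
          Nat.zero_le (k * k * a)]
    calc (d.descFactorial (k + 1)) ^ 2 * n ^ (k + 1)
        = ((d - k) ^ 2 * n) * (d.descFactorial k ^ 2 * n ^ k) := by
          rw [Nat.descFactorial_succ]; ring
      _ ≤ (d ^ 2 * (n - k)) * ((d ^ 2) ^ k * n.descFactorial k) := Nat.mul_le_mul key ih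
      _ = (d ^ 2) ^ (k + 1) * n.descFactorial (k + 1) := by
          rw [Nat.descFactorial_succ]; ring

theorem Nat.choose_sq_le_choose_mul {d n r : ℕ} (hdn : d ≤ n) (hrn : r ≤ n) :
    (d.choose r : ℝ) ^ 2 ≤
      n.choose r * (1 / (r.factorial : ℝ) * ((d : ℝ) ^ 2 / (n : ℝ)) ^ r) := by
  have h : ((d.descFactorial r : ℝ)) ^ 2 * (n : ℝ) ^ r ≤
      ((d : ℝ) ^ 2) ^ r * n.descFactorial r := by
    exact_mod_cast Nat.descFactorial_sq_mul_pow_le hdn r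
  rw [Nat.descFactorial_eq_factorial_mul_choose, Nat.descFactorial_eq_factorial_mul_choose] at h
  push_cast at h
  have hf : (0 : ℝ) < r.factorial := by exact_mod_cast r.factorial_pos
  have hn : (0 : ℝ) < (n : ℝ) ^ r := by
    rcases Nat.eq_zero_or_pos n with rfl | hn
    · obtain rfl : r = 0 := by lia
      simp
    · positivity
  rw [_root_.div_pow, _root_.div_mul_div_comm, one_mul, mul_div_assoc', le_div_iff₀ (by positivity)]
  refine le_of_mul_le_mul_left ?_ hf
  linarith

/-- The expected number of `r`-subsets of `B` contained in a random finset `A` meeting `B` in at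
most `d` points is at most `d.choose r`. -/
theorem sum_measureReal_subset_le_choose {Ω : Type*} [MeasurableSpace Ω] (μ : Measure Ω)
    [IsProbabilityMeasure μ] {p : ℕ} (B : Finset (Fin p)) (d r : ℕ)
    {A : Ω → Finset (Fin p)} (hA : Measurable A) (hcard : ∀ᵐ ω ∂μ, (A ω ∩ B).card ≤ d) :
    ∑ T ∈ B.powersetCard r, μ.real {ω | T ⊆ A ω} ≤ d.choose r := by
  have hmeas (T : Finset (Fin p)) : MeasurableSet {ω | T ⊆ A ω} :=
    hA (t := {S | T ⊆ S}) trivial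
  have hint (T : Finset (Fin p)) : Integrable ({ω | T ⊆ A ω}.indicator (1 : Ω → ℝ)) μ :=
    (integrable_const (1 : ℝ)).indicator (hmeas T)
  calc ∑ T ∈ B.powersetCard r, μ.real {ω | T ⊆ A ω}
      = ∫ ω, ∑ T ∈ B.powersetCard r, {ω | T ⊆ A ω}.indicator (1 : Ω → ℝ) ω ∂μ := by
        rw [integral_finsetSum _ fun T _ => hint T]
        exact Finset.sum_congr rfl fun T _ => (integral_indicator_one (hmeas T)).symm
    _ ≤ ∫ _, (d.choose r : ℝ) ∂μ := by
        refine integral_mono_ae (integrable_finsetSum _ fun T _ => hint T)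
          (integrable_const _) ?_
        filter_upwards [hcard] with ω hω
        have hfilter : (B.powersetCard r).filter (· ⊆ A ω) = (A ω ∩ B).powersetCard r := by
          ext T
          simp only [Finset.mem_filter, Finset.mem_powersetCard, Finset.subset_inter_iff]
          tauto
        simp only [Set.indicator_apply, Set.mem_ofPred_eq, Pi.one_apply, Finset.sum_boole, hfilter,
          Finset.card_powersetCard]
        exact_mod_cast Nat.choose_le_choose r hω
    _ = d.choose r := by simp

/-- Theorem 1 (second inequality): for i.i.d. estimated active sets `Â⁽¹⁾, Â⁽²⁾`, each
containing almost surely at most `d` inactive indices, under the exchangeability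
condition at level `r` and the dimensionality condition `d² ≤ p - |𝒜|`, the probability
that `Â⁽¹⁾ ∩ Â⁽²⁾` contains at least `r` inactive indices is at most
`(1 / r!) (d² / (p - |𝒜|))^r`. -/
theorem sis_theorem1_second_inequality {Ω : Type*} [MeasurableSpace Ω] (μ : Measure Ω)
    [IsProbabilityMeasure μ] {p : ℕ} (𝒜 : Finset (Fin p)) (d r : ℕ)
    (hr : r ≤ p - 𝒜.card) (hd : d ^ 2 ≤ p - 𝒜.card)
    (A1 A2 : Ω → Finset (Fin p)) (hA1 : Measurable A1) (hA2 : Measurable A2)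
    (hindep : IndepFun A1 A2 μ) (hident : Measure.map A1 μ = Measure.map A2 μ)
    (hcard : ∀ᵐ ω ∂μ, ((A1 ω) ∩ 𝒜ᶜ).card ≤ d)
    (hexch : ∀ T ∈ 𝒜ᶜ.powersetCard r, ∀ T' ∈ 𝒜ᶜ.powersetCard r,
      μ {ω | T ⊆ A1 ω} = μ {ω | T' ⊆ A1 ω}) :
    (μ {ω | r ≤ ((A1 ω) ∩ (A2 ω) ∩ 𝒜ᶜ).card}).toReal
      ≤ (1 / (r.factorial : ℝ)) * ((d : ℝ) ^ 2 / ((p - 𝒜.card : ℕ) : ℝ)) ^ r := by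
  have hmeas (T : Finset (Fin p)) : MeasurableSet {S : Finset (Fin p) | T ⊆ S} := trivial
  have hBcard : (𝒜ᶜ).card = p - 𝒜.card := by rw [Finset.card_compl, Fintype.card_fin]
  have hprod (T : Finset (Fin p)) :
      μ.real {ω | T ⊆ A1 ω ∧ T ⊆ A2 ω} = μ.real {ω | T ⊆ A1 ω} ^ 2 := by
    have h2 : μ {ω | T ⊆ A2 ω} = μ {ω | T ⊆ A1 ω} := by
      have h := congrArg (fun ν => ν {S : Finset (Fin p) | T ⊆ S}) hident
      simp only [Measure.map_apply hA1 (hmeas T), Measure.map_apply hA2 (hmeas T)] at h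
      exact h.symm
    have h := hindep.measure_inter_preimage_eq_mul _ _ (hmeas T) (hmeas T)
    change μ {ω | T ⊆ A1 ω ∧ T ⊆ A2 ω} = μ {ω | T ⊆ A1 ω} * μ {ω | T ⊆ A2 ω} at h
    rw [measureReal_def, h, h2, ENNReal.toReal_mul, sq, measureReal_def]
  obtain ⟨T₀, hT₀⟩ : (𝒜ᶜ.powersetCard r).Nonempty :=
    Finset.powersetCard_nonempty.2 (hBcard ▸ hr)
  set q := μ.real {ω | T₀ ⊆ A1 ω}
  have hconst : ∀ T ∈ 𝒜ᶜ.powersetCard r, μ.real {ω | T ⊆ A1 ω} = q := fun T hT =>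
    congrArg ENNReal.toReal (hexch T hT T₀ hT₀)
  have hsum := sum_measureReal_subset_le_choose μ 𝒜ᶜ d r hA1 hcard
  rw [Finset.sum_congr rfl hconst, Finset.sum_const, Finset.card_powersetCard, hBcard,
    nsmul_eq_mul] at hsum
  have hunion : μ.real {ω | r ≤ ((A1 ω) ∩ (A2 ω) ∩ 𝒜ᶜ).card} ≤
      (p - 𝒜.card).choose r * q ^ 2 := by
    calc μ.real {ω | r ≤ ((A1 ω) ∩ (A2 ω) ∩ 𝒜ᶜ).card}
        ≤ μ.real (⋃ T ∈ 𝒜ᶜ.powersetCard r, {ω | T ⊆ A1 ω ∧ T ⊆ A2 ω}) := by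
          refine measureReal_mono (fun ω hω => ?_) (measure_ne_top μ _)
          obtain ⟨T, hT, hTr⟩ := Finset.exists_subset_card_eq hω
          simp only [Finset.subset_inter_iff] at hT
          simp only [Set.mem_iUnion, Finset.mem_powersetCard]
          exact ⟨T, ⟨hT.2, hTr⟩, hT.1⟩
      _ ≤ ∑ T ∈ 𝒜ᶜ.powersetCard r, μ.real {ω | T ⊆ A1 ω ∧ T ⊆ A2 ω} :=
          measureReal_biUnion_finset_le _ _
      _ = (p - 𝒜.card).choose r * q ^ 2 := by
          rw [Finset.sum_congr rfl fun T hT => (hprod T).trans (by rw [hconst T hT]),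
            Finset.sum_const, Finset.card_powersetCard, hBcard, nsmul_eq_mul]
  have hN : (0 : ℝ) < (p - 𝒜.card).choose r := by exact_mod_cast Nat.choose_pos hr
  refine le_of_mul_le_mul_left ?_ hN
  calc ((p - 𝒜.card).choose r : ℝ) * μ.real {ω | r ≤ ((A1 ω) ∩ (A2 ω) ∩ 𝒜ᶜ).card}
      ≤ (p - 𝒜.card).choose r * ((p - 𝒜.card).choose r * q ^ 2) := by gcongr
    _ = ((p - 𝒜.card).choose r * q) ^ 2 := by ring
    _ ≤ (d.choose r : ℝ) ^ 2 := by gcongr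
    _ ≤ _ := Nat.choose_sq_le_choose_mul ((Nat.le_self_pow two_ne_zero d).trans hd) hr
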